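/- arXiv:2308.08165 — 2 statements merged into one kernel-verified Lean document; each statement's English description precedes it below -/
import Mathlib

section
/- Let a_1, …, a_N, b ∈ ℝ^d, a = (1/N)·Σ_{i=1}^N a_i, and 1 ≤ S ≤ N. If 𝒮 is a uniformly random subset of {1, …, N} of size S (sampling without replacement), then E[‖(1/S)·Σ_{i∈𝒮} a_i‖²] ≤ ‖a‖² + (1/(SN))·Σ_{i=1}^N ‖a_i − a‖² ≤ ‖a‖² + (1/(SN))·Σ_{i=1}^N ‖a_i − b‖². -/
open Finset

section Sampling

variable {ι E : Type*} [Fintype ι] [NormedAddCommGroup E] [InnerProductSpace ℝ E]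

/-- The sum of squared distances to a point is minimal at the mean. -/
lemma sum_norm_sub_sq_le_of_sum_sub_eq_zero (a : ι → E) (m b : E) (hm : ∑ i, (a i - m) = 0) :
    ∑ i, ‖a i - m‖ ^ 2 ≤ ∑ i, ‖a i - b‖ ^ 2 := by
  have h (i : ι) : ‖a i - b‖ ^ 2 =
      ‖a i - m‖ ^ 2 + 2 * inner ℝ (a i - m) (m - b) + ‖m - b‖ ^ 2 := by
    rw [← norm_add_sq_real, sub_add_sub_cancel]
  simp_rw [h]
  rw [sum_add_distrib, sum_add_distrib, ← mul_sum, ← sum_inner, hm, inner_zero_left]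
  have : 0 ≤ ∑ _i : ι, ‖m - b‖ ^ 2 := by positivity
  linarith

variable [DecidableEq ι]

/-- The number of `S`-element subsets of a finite type containing a given point. -/
lemma card_filter_mem_powersetCard_univ {S : ℕ} (hS : 1 ≤ S) (i : ι) :
    #{s ∈ powersetCard S (univ : Finset ι) | i ∈ s} =
      (Fintype.card ι - 1).choose (S - 1) := by
  simpa using card_filter_powersetCard_subset {i} (univ : Finset ι) S (subset_univ _) (by simpa)

/-- The number of `S`-element subsets containing two distinct points does not depend on them. -/
lemma exists_card_filter_mem_mem_powersetCard_univ (S : ℕ) :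
    ∃ q : ℕ, ∀ i j : ι, i ≠ j →
      #{s ∈ powersetCard S (univ : Finset ι) | i ∈ s ∧ j ∈ s} = q := by
  rcases le_or_gt 2 S with hS | hS
  · refine ⟨(Fintype.card ι - 2).choose (S - 2), fun i j hij => ?_⟩
    have h := card_filter_powersetCard_subset {i, j} (univ : Finset ι) S (subset_univ _)
      (by rwa [card_pair hij])
    simpa [card_pair hij, insert_subset_iff] using h
  · refine ⟨0, fun i j hij => ?_⟩
    rw [card_eq_zero, filter_eq_empty_iff]
    rintro s hs ⟨hi, hj⟩
    have h : #{i, j} ≤ #s := card_le_card (by simp [insert_subset_iff, hi, hj])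
    rw [card_pair hij, (mem_powersetCard.1 hs).2] at h
    omega

lemma sum_powersetCard_univ_sum {M : Type*} [AddCommMonoid M] {S : ℕ} (hS : 1 ≤ S)
    (c : ι → M) :
    ∑ s ∈ powersetCard S (univ : Finset ι), ∑ i ∈ s, c i =
      (Fintype.card ι - 1).choose (S - 1) • ∑ i, c i := by
  have h (s : Finset ι) : ∑ i ∈ s, c i = ∑ i, if i ∈ s then c i else 0 := by simp
  rw [sum_congr rfl fun s _ => h s, sum_comm, smul_sum]
  refine sum_congr rfl fun i _ => ?_
  rw [← sum_filter, sum_const, card_filter_mem_powersetCard_univ hS]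

/-- For a centered family, summing the squared norms of the partial sums over all `S`-element
subsets gives at most the value obtained by ignoring the cross terms. -/
lemma sum_powersetCard_univ_norm_sq_sum_le {S : ℕ} (hS : 1 ≤ S) (c : ι → E)
    (hc : ∑ i, c i = 0) :
    ∑ s ∈ powersetCard S (univ : Finset ι), ‖∑ i ∈ s, c i‖ ^ 2 ≤
      (Fintype.card ι - 1).choose (S - 1) * ∑ i, ‖c i‖ ^ 2 := by
  obtain ⟨q, hq⟩ := exists_card_filter_mem_mem_powersetCard_univ (ι := ι) S
  set p := (Fintype.card ι - 1).choose (S - 1)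
  have expand (s : Finset ι) : ‖∑ i ∈ s, c i‖ ^ 2 =
      ∑ i, ∑ j, if i ∈ s ∧ j ∈ s then inner ℝ (c i) (c j) else 0 := by
    rw [← real_inner_self_eq_norm_sq, sum_inner]
    simp [inner_sum, ite_and]
  have count (i j : ι) : (#{s ∈ powersetCard S (univ : Finset ι) | i ∈ s ∧ j ∈ s} : ℝ) =
      q + if i = j then (p - q : ℝ) else 0 := by
    split_ifs with h
    · subst h
      simp [card_filter_mem_powersetCard_univ hS, p]
    · simp [hq i j h]
  have cross : ∑ i, ∑ j, inner ℝ (c i) (c j) = 0 := by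
    simp [← inner_sum, hc]
  calc ∑ s ∈ powersetCard S (univ : Finset ι), ‖∑ i ∈ s, c i‖ ^ 2
      = ∑ i, ∑ j, (q + if i = j then (p - q : ℝ) else 0) * inner ℝ (c i) (c j) := by
        simp_rw [expand]
        rw [sum_comm]
        refine sum_congr rfl fun i _ => ?_
        rw [sum_comm]
        refine sum_congr rfl fun j _ => ?_
        rw [← sum_filter, sum_const, nsmul_eq_mul, count]
    _ = q * ∑ i, ∑ j, inner ℝ (c i) (c j) + (p - q) * ∑ i, ‖c i‖ ^ 2 := by
        simp [add_mul, sum_add_distrib, mul_sum, ite_mul]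
    _ ≤ p * ∑ i, ‖c i‖ ^ 2 := by
        rw [cross, mul_zero, zero_add]
        gcongr
        simp

end Sampling


/-- **Sampling without replacement (Lemma of Cheng et al.).**
For `a₁, …, a_N, b ∈ ℝ^d`, `a = (1/N) ∑ᵢ aᵢ`, and a uniformly random subset `𝒮 ⊆ {1,…,N}`
of size `S` (sampling without replacement, the expectation being the uniform average over
all `binomial(N,S)` subsets of cardinality `S`):
`E‖(1/S) ∑_{i∈𝒮} aᵢ‖² ≤ ‖a‖² + (1/(SN)) ∑ᵢ ‖aᵢ − a‖² ≤ ‖a‖² + (1/(SN)) ∑ᵢ ‖aᵢ − b‖²`. -/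
theorem sampling_without_replacement
    {d N : ℕ} (S : ℕ) (hS : 1 ≤ S) (hSN : S ≤ N)
    (a : Fin N → EuclideanSpace ℝ (Fin d)) (b : EuclideanSpace ℝ (Fin d))
    (abar : EuclideanSpace ℝ (Fin d))
    (habar : abar = (N : ℝ)⁻¹ • ∑ i, a i) :
    ((N.choose S : ℝ))⁻¹ *
        ∑ s ∈ Finset.powersetCard S (Finset.univ : Finset (Fin N)),
          ‖(S : ℝ)⁻¹ • ∑ i ∈ s, a i‖ ^ 2
      ≤ ‖abar‖ ^ 2 + ((S : ℝ) * N)⁻¹ * ∑ i, ‖a i - abar‖ ^ 2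
    ∧ ‖abar‖ ^ 2 + ((S : ℝ) * N)⁻¹ * ∑ i, ‖a i - abar‖ ^ 2
      ≤ ‖abar‖ ^ 2 + ((S : ℝ) * N)⁻¹ * ∑ i, ‖a i - b‖ ^ 2 := by
  have hS0 : (0 : ℝ) < S := by exact_mod_cast hS
  have hN0 : (0 : ℝ) < N := by exact_mod_cast hS.trans hSN
  have centered : ∑ i, (a i - abar) = 0 := by
    rw [sum_sub_distrib, sum_const, card_univ, Fintype.card_fin, habar,
      ← Nat.cast_smul_eq_nsmul ℝ, smul_smul, mul_inv_cancel₀ hN0.ne', one_smul, sub_self]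
  refine ⟨?_, add_le_add_right (mul_le_mul_of_nonneg_left
    (sum_norm_sub_sq_le_of_sum_sub_eq_zero a abar b centered) (by positivity)) _⟩
  have hC : (0 : ℝ) < N.choose S := by exact_mod_cast Nat.choose_pos hSN
  have hP : (N : ℝ) * (N - 1).choose (S - 1) = N.choose S * S := by
    have h := Nat.add_one_mul_choose_eq (N - 1) (S - 1)
    rw [Nat.sub_add_cancel hS, Nat.sub_add_cancel (hS.trans hSN)] at h
    exact_mod_cast h
  have expand : ∀ s ∈ powersetCard S (univ : Finset (Fin N)),
      ‖(S : ℝ)⁻¹ • ∑ i ∈ s, a i‖ ^ 2 = ‖abar‖ ^ 2 +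
        2 * (S : ℝ)⁻¹ * inner ℝ abar (∑ i ∈ s, (a i - abar)) +
        ((S : ℝ)⁻¹) ^ 2 * ‖∑ i ∈ s, (a i - abar)‖ ^ 2 := by
    intro s hs
    have h : (S : ℝ)⁻¹ • ∑ i ∈ s, a i = abar + (S : ℝ)⁻¹ • ∑ i ∈ s, (a i - abar) := by
      rw [sum_sub_distrib, sum_const, (mem_powersetCard.1 hs).2, ← Nat.cast_smul_eq_nsmul ℝ,
        smul_sub, smul_smul, inv_mul_cancel₀ hS0.ne', one_smul, add_sub_cancel]
    rw [h, norm_add_sq_real, inner_smul_right, norm_smul, mul_pow, Real.norm_eq_abs, sq_abs]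
    ring
  have key := sum_powersetCard_univ_norm_sq_sum_le hS (fun i => a i - abar) centered
  rw [Fintype.card_fin] at key
  rw [sum_congr rfl expand, sum_add_distrib, sum_add_distrib, ← mul_sum, ← mul_sum,
    ← inner_sum, sum_powersetCard_univ_sum hS, centered, smul_zero, inner_zero_right, sum_const,
    card_powersetCard, card_univ, Fintype.card_fin, nsmul_eq_mul, mul_zero, add_zero, mul_add,
    inv_mul_cancel_left₀ hC.ne']
  refine add_le_add_right ?_ _
  calc (N.choose S : ℝ)⁻¹ * (((S : ℝ)⁻¹) ^ 2 *
        ∑ s ∈ powersetCard S (univ : Finset (Fin N)), ‖∑ i ∈ s, (a i - abar)‖ ^ 2)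
      ≤ (N.choose S : ℝ)⁻¹ * (((S : ℝ)⁻¹) ^ 2 *
        ((N - 1).choose (S - 1) * ∑ i, ‖a i - abar‖ ^ 2)) := by gcongr
    _ = ((S : ℝ) * N)⁻¹ * ∑ i, ‖a i - abar‖ ^ 2 := by
        rw [← mul_assoc, ← mul_assoc]
        congr 1
        field_simp
        linarith
end

section
/- Let {I_1, …, I_M} be a partition of {1, …, d} into nonempty groups, and define the grouped-sign operator C : ℝ^d → ℝ^d coordinatewise by C(x)_j = (‖x_{I_m}‖₁/|I_m|)·sign(x_j) for j ∈ I_m, where ‖x_{I_m}‖₁ = Σ_{j∈I_m}|x_j| and sign(0) = 0. Then for every x ∈ ℝ^d, ‖C(x) − x‖² ≤ (1 − 1/max_{1≤m≤M}|I_m|)·‖x‖²; that is, the grouped sign operator is a q²-contractive compressor with q² = 1 − 1/max_m |I_m|. -/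
open Finset

/-- Scaling the sign vector of `x` on `s` by the mean of `|x|` over `s` contracts the squared
error by a factor `1 - 1 / #s`. -/
theorem sum_mean_abs_mul_sign_sub_sq_le {ι : Type*} (s : Finset ι) (hs : s.Nonempty) (x : ι → ℝ) :
    ∑ j ∈ s, ((∑ l ∈ s, |x l|) / (s.card : ℝ) * Real.sign (x j) - x j) ^ 2
      ≤ (1 - 1 / (s.card : ℝ)) * ∑ j ∈ s, x j ^ 2 := by
  have hn : (0 : ℝ) < s.card := by exact_mod_cast hs.card_pos
  have hQ : ∑ j ∈ s, x j ^ 2 ≤ (∑ l ∈ s, |x l|) ^ 2 := by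
    simpa only [sq_abs] using sum_sq_le_sq_sum_of_nonneg (s := s) (f := fun l => |x l|)
      fun l _ => abs_nonneg (x l)
  set S := ∑ l ∈ s, |x l| with hS
  have hterm (j : ι) : (S / s.card * Real.sign (x j) - x j) ^ 2
      ≤ (S / s.card) ^ 2 - 2 * (S / s.card) * |x j| + x j ^ 2 := by
    rcases lt_trichotomy (x j) 0 with h | h | h
    · rw [Real.sign_of_neg h, abs_of_neg h]
      exact le_of_eq (by ring)
    · simp [h, sq_nonneg]
    · rw [Real.sign_of_pos h, abs_of_pos h]
      exact le_of_eq (by ring)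
  calc ∑ j ∈ s, (S / s.card * Real.sign (x j) - x j) ^ 2
      ≤ ∑ j ∈ s, ((S / s.card) ^ 2 - 2 * (S / s.card) * |x j| + x j ^ 2) :=
        sum_le_sum fun j _ => hterm j
    _ = ∑ j ∈ s, x j ^ 2 - S ^ 2 / s.card := by
        rw [sum_add_distrib, sum_sub_distrib, ← mul_sum, ← hS, sum_const, nsmul_eq_mul]
        field_simp
        ring
    _ ≤ ∑ j ∈ s, x j ^ 2 - (∑ j ∈ s, x j ^ 2) / s.card := by gcongr
    _ = (1 - 1 / (s.card : ℝ)) * ∑ j ∈ s, x j ^ 2 := by ring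

/-- **Grouped sign operator is `q²`-contractive with `q² = 1 − 1/max_m |I_m|`.**
Let `{I₁,…,I_M}` be a partition of `{1,…,d}` into nonempty groups and define
`C(x)_j = (‖x_{I_m}‖₁ / |I_m|) · sign(x_j)` for `j ∈ I_m`.  Then for every `x ∈ ℝ^d`,
`‖C(x) − x‖² ≤ (1 − 1/max_{1≤m≤M} |I_m|) ‖x‖²`. -/
theorem grouped_sign_contractive
    {d M : ℕ} (hM : 0 < M)
    (I : Fin M → Finset (Fin d))
    (hne : ∀ m, (I m).Nonempty)
    (hdisj : ∀ m m', m ≠ m' → Disjoint (I m) (I m'))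
    (hcover : ∀ j, ∃ m, j ∈ I m)
    (x C : EuclideanSpace ℝ (Fin d))
    (hC : ∀ m, ∀ j ∈ I m,
      C j = ((∑ l ∈ I m, |x l|) / ((I m).card : ℝ)) * Real.sign (x j)) :
    ‖C - x‖ ^ 2
      ≤ (1 - 1 / ((Finset.univ.sup fun m => (I m).card : ℕ) : ℝ)) * ‖x‖ ^ 2 := by
  have hsum (f : Fin d → ℝ) : ∑ j, f j = ∑ m, ∑ j ∈ I m, f j := by
    rw [← sum_biUnion fun m _ m' _ h => hdisj m m' h]
    congr 1
    ext j
    simpa using hcover j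
  rw [EuclideanSpace.real_norm_sq_eq, EuclideanSpace.real_norm_sq_eq, hsum, hsum, mul_sum]
  refine sum_le_sum fun m _ => ?_
  calc ∑ j ∈ I m, (C - x) j ^ 2
      = ∑ j ∈ I m, ((∑ l ∈ I m, |x l|) / ((I m).card : ℝ) * Real.sign (x j) - x j) ^ 2 :=
        sum_congr rfl fun j hj => by rw [PiLp.sub_apply, hC m j hj]
    _ ≤ (1 - 1 / ((I m).card : ℝ)) * ∑ j ∈ I m, x j ^ 2 :=
        sum_mean_abs_mul_sign_sub_sq_le (I m) (hne m) x
    _ ≤ _ := by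
        have hpos : (0 : ℝ) < (I m).card := by exact_mod_cast (hne m).card_pos
        have hle : (I m).card ≤ univ.sup fun m => (I m).card :=
          le_sup (f := fun m => (I m).card) (mem_univ m)
        gcongr
end
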